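/- Let k, d be natural numbers with d ≥ 1 and let f : ℕ → ℕ be a function satisfying f(i) ≤ d − 1 for all i < k. Then k + ∑_{i=0}^{k-1} c_{i, f(i)} ≤ c_{k,d}. -/

import Mathlib

/-- `c k d = ∑_{h=1}^{min(k,d)} binom(k,h)`. -/
def ckd (k d : ℕ) : ℕ := ∑ h ∈ Finset.Icc 1 (min k d), Nat.choose k h

theorem ckd_eq_aux (k d : ℕ) : ckd k d = ∑ h ∈ Finset.range d, Nat.choose k (h + 1) := by
  have h2 : ∑ h ∈ Finset.range d, Nat.choose k (h + 1) = ∑ h ∈ Finset.Icc 1 d, Nat.choose k h := by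
    induction d with
    | zero => simp
    | succ n ih => rw [Finset.sum_range_succ, ih, Finset.sum_Icc_succ_top (by omega)]
  rw [h2, ckd]
  apply Finset.sum_subset
  · intro x hx
    simp only [Finset.mem_Icc] at *
    omega
  · intro x hx hx'
    simp only [Finset.mem_Icc] at *
    exact Nat.choose_eq_zero_of_lt (by omega)

theorem ckd_succ_aux (k e : ℕ) : ckd (k + 1) (e + 1) = ckd k (e + 1) + (1 + ckd k e) := by
  simp only [ckd_eq_aux, Nat.choose_succ_succ', Finset.sum_add_distrib]
  rw [Finset.sum_range_succ' (fun h => Nat.choose k h)]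
  simp only [Nat.choose_zero_right]
  omega

theorem ckd_mono_aux (k a b : ℕ) (h : a ≤ b) : ckd k a ≤ ckd k b := by
  simp only [ckd_eq_aux]
  exact Finset.sum_le_sum_of_subset (Finset.range_mono h)

theorem ckd_case1_bound (k d : ℕ) (hd : 1 ≤ d) (f : ℕ → ℕ)
    (hf : ∀ i < k, f i ≤ d - 1) :
    k + ∑ i ∈ Finset.range k, ckd i (f i) ≤ ckd k d := by
  obtain ⟨e, rfl⟩ : ∃ e, d = e + 1 := ⟨d - 1, by omega⟩
  induction k with
  | zero => simp
  | succ n ih =>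
    have h1 := ih (fun i hi => hf i (by omega))
    have h2 := ckd_mono_aux n (f n) e (by simpa using hf n (by omega))
    rw [Finset.sum_range_succ, ckd_succ_aux]
    omega
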